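/- arXiv:1008.5017 — 2 statements merged into one kernel-verified Lean document; each statement's English description precedes it below -/
import Mathlib

section
/- For positive integers n, m and vectors X₁,…,X_n, Y₁,…,Y_m in a symplectic vector space H, viewing N(X₁⋯X_n) and N(Y₁⋯Y_m) as derivations of the completed tensor algebra via Poincaré duality, their Lie bracket as derivations equals −Σᵢ Σⱼ (Xᵢ·Yⱼ) N(X_{i+1}⋯X_n X₁⋯X_{i−1} Y_{j+1}⋯Y_m Y₁⋯Y_{j−1}). -/
/-! Model of the completed tensor algebra `T̂` of `H = ℚ^d`: an element of `T̂`
is a function assigning to each word in the basis letters (elements of `Fin d`)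
its coefficient. -/

namespace Paper

/-- words in the basis letters of `H` -/
abbrev Word (d : ℕ) := List (Fin d)

/-- the completed tensor algebra, as coefficient functions on words -/
abbrev Ten (d : ℕ) := Word d → ℚ

variable {d : ℕ}

/-- the unit `1 ∈ T̂` -/
def oneT : Ten d := fun w => if w = [] then 1 else 0

/-- the (concatenation) product of `T̂` -/
def mulT (f g : Ten d) : Ten d :=
  fun w => ∑ k ∈ Finset.range (w.length + 1), f (List.take k w) * g (List.drop k w)

/-- the commutator bracket `[a,b] = ab - ba` -/
def brT (f g : Ten d) : Ten d := mulT f g - mulT g f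

/-- powers -/
def powT (f : Ten d) : ℕ → Ten d
  | 0 => oneT
  | n + 1 => mulT f (powT f n)

/-- the cyclic symmetrization operator `N`, with `N|_{H^{⊗p}} = ∑_{m<p} ν^m`
and `N = 0` in degree `0`. -/
def Nop (f : Ten d) : Ten d := fun w => ∑ m ∈ Finset.range w.length, f (w.rotate m)

/-- the cyclic permutation `ν` -/
def nuT (f : Ten d) : Ten d := fun w => f (w.rotate (w.length - 1))

/-- being an element of `H ⊂ T̂` (homogeneous of degree 1) -/
def deg1 (f : Ten d) : Prop := ∀ w : Word d, w.length ≠ 1 → f w = 0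

/-- the intersection (symplectic) pairing on the basis of `H = ℚ^{2g}`:
`(A_i · B_i) = 1`, `(B_i · A_i) = -1`, all other pairings `0`, where
`A_i, B_i` are the letters `2i, 2i+1`. -/
def pairC {g : ℕ} (a b : Fin (2 * g)) : ℚ :=
  if a.val % 2 = 0 ∧ b.val = a.val + 1 then 1
  else if b.val % 2 = 0 ∧ a.val = b.val + 1 then -1 else 0

/-- the symplectic form `ω = ∑ A_i B_i - B_i A_i ∈ H^{⊗2}` -/
def omegaT (g : ℕ) : Ten (2 * g) :=
  fun w => ∑ a : Fin (2 * g), ∑ b : Fin (2 * g),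
    pairC a b * (if w = [a, b] then 1 else 0)

/-- the value on the basis letter `b` of the derivation associated to
`f ∈ H ⊗ T̂` via Poincaré duality `X ⊗ u ↦ (Y ↦ (Y·X)u)` -/
def phiD {g : ℕ} (f : Ten (2 * g)) (b : Fin (2 * g)) : Ten (2 * g) :=
  fun m => ∑ c : Fin (2 * g), pairC b c * f (c :: m)

/-- the derivation of `T̂` associated to `f ∈ H ⊗ T̂` via Poincaré duality,
extended to all of `T̂` by the Leibniz rule. -/
def derOf {g : ℕ} (f t : Ten (2 * g)) : Ten (2 * g) :=
  fun w => ∑ i ∈ Finset.range (w.length + 1), ∑ j ∈ Finset.Icc i w.length,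
    ∑ b : Fin (2 * g), t (w.take i ++ b :: w.drop j) * phiD f b ((w.take j).drop i)

/-- the intersection pairing of two elements of `H` -/
def pairT {g : ℕ} (u v : Ten (2 * g)) : ℚ :=
  ∑ a : Fin (2 * g), ∑ b : Fin (2 * g), u [a] * v [b] * pairC a b

/-- the product of a list of elements of `T̂` -/
def prodL : List (Ten d) → Ten d
  | [] => oneT
  | x :: l => mulT x (prodL l)

/-- the bracket map `H ⊗ T̂ → T̂`, `X ⊗ u ↦ [X,u] = Xu - uX`, in coefficients. -/
def brMap (f : Ten d) : Ten d := fun w => f w - f (w.rotate (w.length - 1))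

/-- the product of `T̂` as a bilinear map -/
def mulL : Ten d →ₗ[ℚ] Ten d →ₗ[ℚ] Ten d :=
  LinearMap.mk₂ ℚ mulT
    (fun f g h => by ext w; simp [mulT, add_mul, Finset.sum_add_distrib])
    (fun c f g => by ext w; simp [mulT, mul_assoc, Finset.mul_sum])
    (fun f g h => by ext w; simp [mulT, mul_add, Finset.sum_add_distrib])
    (fun c f g => by ext w; simp [mulT, mul_left_comm, Finset.mul_sum])

/-- the left quotient of `t` by the letter `a` -/
def lquot (a : Fin d) : Ten d →ₗ[ℚ] Ten d where
  toFun t := fun w => t (a :: w)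
  map_add' _ _ := rfl
  map_smul' _ _ := rfl

@[simp] theorem lquot_apply (a : Fin d) (t : Ten d) (w : Word d) : lquot a t w = t (a :: w) := rfl

theorem mulL_apply (f g : Ten d) (w : Word d) :
    mulL f g w = ∑ k ∈ Finset.range (w.length + 1), f (w.take k) * g (w.drop k) := rfl

theorem mulL_nil (f g : Ten d) : mulL f g [] = f [] * g [] := by simp [mulL_apply]

theorem mulL_cons (f g : Ten d) (a : Fin d) (w : Word d) :
    mulL f g (a :: w) = f [] * g (a :: w) + mulL (lquot a f) g w := by
  simp only [mulL_apply, List.length_cons]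
  rw [Finset.sum_range_succ']
  simp [add_comm]

theorem lquot_mulL (f g : Ten d) (a : Fin d) :
    lquot a (mulL f g) = f [] • lquot a g + mulL (lquot a f) g := by
  ext w
  simp [mulL_cons]

theorem mulL_assoc (f g h : Ten d) : mulL (mulL f g) h = mulL f (mulL g h) := by
  ext w
  induction w generalizing f with
  | nil => simp [mulL_nil, mul_assoc]
  | cons a w ih =>
    simp only [mulL_cons, lquot_mulL, mulL_nil, map_add, map_smul, LinearMap.add_apply,
      LinearMap.smul_apply, Pi.add_apply, Pi.smul_apply, smul_eq_mul, ih]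
    ring

theorem mulL_oneT (f : Ten d) : mulL oneT f = f := by
  ext w
  cases w with
  | nil => simp [mulL_nil, oneT]
  | cons a w =>
    have h : lquot a (oneT : Ten d) = 0 := by ext v; simp [oneT]
    simp [mulL_cons, oneT, h]

theorem prodL_cons (x : Ten d) (l : List (Ten d)) : prodL (x :: l) = mulL x (prodL l) := rfl

theorem prodL_append (l l' : List (Ten d)) : prodL (l ++ l') = mulL (prodL l) (prodL l') := by
  induction l with
  | nil => exact (mulL_oneT _).symm
  | cons x l ih => rw [List.cons_append, prodL_cons, ih, prodL_cons, mulL_assoc]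

/-- the derivation of `T̂` with prescribed values `φ` on the letters -/
def derL (φ : Fin d → Ten d) : Ten d →ₗ[ℚ] Ten d where
  toFun t := fun w => ∑ i ∈ Finset.range (w.length + 1), ∑ j ∈ Finset.Icc i w.length,
    ∑ b : Fin d, t (w.take i ++ b :: w.drop j) * φ b ((w.take j).drop i)
  map_add' _ _ := by ext w; simp [add_mul, Finset.sum_add_distrib]
  map_smul' _ _ := by ext w; simp [mul_assoc, Finset.mul_sum]

theorem derL_apply (φ : Fin d → Ten d) (t : Ten d) (w : Word d) :
    derL φ t w = ∑ i ∈ Finset.range (w.length + 1), ∑ j ∈ Finset.Icc i w.length,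
      ∑ b : Fin d, t (w.take i ++ b :: w.drop j) * φ b ((w.take j).drop i) := rfl

/-- the part of `derL φ t` where the first letter is replaced -/
def derHead (φ : Fin d → Ten d) (t : Ten d) : Ten d := ∑ b : Fin d, mulL (φ b) (lquot b t)

theorem derHead_apply (φ : Fin d → Ten d) (t : Ten d) (w : Word d) :
    derHead φ t w = ∑ j ∈ Finset.Icc 0 w.length,
      ∑ b : Fin d, t (b :: w.drop j) * φ b (w.take j) := by
  rw [Finset.sum_comm]
  simp [derHead, mulL_apply, mul_comm, Nat.range_succ_eq_Icc_zero]

theorem derL_nil (φ : Fin d → Ten d) (t : Ten d) : derL φ t [] = derHead φ t [] := by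
  simp [derL_apply, derHead_apply]

theorem derL_cons (φ : Fin d → Ten d) (t : Ten d) (a : Fin d) (w : Word d) :
    derL φ t (a :: w) = derHead φ t (a :: w) + derL φ (lquot a t) w := by
  rw [derL_apply, List.length_cons, Finset.sum_range_succ', add_comm, derHead_apply, derL_apply]
  congr 1
  refine Finset.sum_congr rfl fun i _ => ?_
  rw [← Finset.Ico_add_one_right_eq_Icc, ← Finset.Ico_add_one_right_eq_Icc, ← Finset.sum_Ico_add']
  simp

/-- the part of `derL φ t` where the first letter is kept -/
def derTail (φ : Fin d → Ten d) (t : Ten d) : Ten d := derL φ t - derHead φ t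

theorem derL_eq (φ : Fin d → Ten d) (t : Ten d) : derL φ t = derHead φ t + derTail φ t := by
  simp [derTail]

theorem derTail_nil (φ : Fin d → Ten d) (t : Ten d) : derTail φ t [] = 0 := by
  simp [derTail, derL_nil]

theorem lquot_derTail (φ : Fin d → Ten d) (t : Ten d) (a : Fin d) :
    lquot a (derTail φ t) = derL φ (lquot a t) := by
  ext w
  simp [derTail, derL_cons]

theorem derHead_mulL (φ : Fin d → Ten d) (f g : Ten d) :
    derHead φ (mulL f g) = f [] • derHead φ g + mulL (derHead φ f) g := by
  simp [derHead, lquot_mulL, Finset.sum_add_distrib, Finset.smul_sum, mulL_assoc]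

/-- the Leibniz rule -/
theorem derL_mulL (φ : Fin d → Ten d) (f g : Ten d) :
    derL φ (mulL f g) = mulL (derL φ f) g + mulL f (derL φ g) := by
  ext w
  induction w generalizing f with
  | nil => simp [derL_nil, derHead_mulL, mulL_nil, add_comm]
  | cons a w ih =>
    have h : lquot a (derL φ f) = lquot a (derHead φ f) + derL φ (lquot a f) := by
      rw [← lquot_derTail, ← map_add, ← derL_eq]
    simp only [derL_cons, derHead_mulL, lquot_mulL, map_add, map_smul, Pi.add_apply,
      Pi.smul_apply, smul_eq_mul, ih, mulL_cons, h, LinearMap.add_apply, derL_nil]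
    ring

theorem derL_derHead (φ ψ : Fin d → Ten d) (t : Ten d) :
    derL φ (derHead ψ t) = derHead (fun b => derL φ (ψ b)) t
      + ∑ b : Fin d, mulL (ψ b) (derL φ (lquot b t)) := by
  simp [derHead, derL_mulL, Finset.sum_add_distrib]

theorem derHead_derTail (φ ψ : Fin d → Ten d) (t : Ten d) :
    derHead φ (derTail ψ t) = ∑ b : Fin d, mulL (φ b) (derL ψ (lquot b t)) := by
  simp [derHead, lquot_derTail]

theorem derHead_sub (φ ψ : Fin d → Ten d) (t : Ten d) :
    derHead (fun b => φ b - ψ b) t = derHead φ t - derHead ψ t := by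
  simp [derHead]

/-- the commutator of two derivations is the derivation given by its values on the letters -/
theorem derL_commutator (φ ψ : Fin d → Ten d) (t : Ten d) :
    derL φ (derL ψ t) - derL ψ (derL φ t)
      = derL (fun b => derL φ (ψ b) - derL ψ (φ b)) t := by
  have key (φ ψ : Fin d → Ten d) (t : Ten d) : derL φ (derL ψ t)
      = derHead (fun b => derL φ (ψ b)) t + ∑ b : Fin d, mulL (ψ b) (derL φ (lquot b t))
        + derL φ (derTail ψ t) := by
    rw [derL_eq ψ t, map_add, derL_derHead]
  ext w
  induction w generalizing t with
  | nil =>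
    rw [key φ ψ, key ψ φ, derL_nil, derHead_sub]
    simp only [Pi.sub_apply, Pi.add_apply, derL_nil, derHead_derTail]
    ring
  | cons a w ih =>
    rw [derL_cons, ← ih, key φ ψ, key ψ φ, derHead_sub]
    simp only [Pi.sub_apply, Pi.add_apply, derL_cons, derHead_derTail, lquot_derTail]
    ring

theorem sum_rotate_succ (F : Word d → ℚ) (v : Word d) :
    ∑ r ∈ Finset.range v.length, F (v.rotate r)
      = ∑ r ∈ Finset.range v.length, F (v.rotate (r + 1)) := by
  have h := (Finset.sum_range_succ (fun m => F (v.rotate m)) v.length).symm.trans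
    (Finset.sum_range_succ' (fun m => F (v.rotate m)) v.length)
  simpa using h

theorem Nop_rotate (f : Ten d) (w : Word d) (r : ℕ) : Nop f (w.rotate r) = Nop f w := by
  induction r with
  | zero => simp
  | succ r ih =>
    rw [← ih, ← List.rotate_rotate]
    generalize w.rotate r = v
    simp [Nop, List.rotate_rotate, sum_rotate_succ f v, add_comm 1]

theorem Nop_append_comm (f : Ten d) (u v : Word d) : Nop f (u ++ v) = Nop f (v ++ u) := by
  rw [← Nop_rotate f (u ++ v) u.length, List.rotate_append_length_eq]

theorem prodL_cons_cons {x : Ten d} (hx : deg1 x) (l : List (Ten d)) (a : Fin d) (w : Word d) :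
    prodL (x :: l) (a :: w) = x [a] * prodL l w := by
  have h : lquot a x = x [a] • oneT := by
    ext v
    cases v with
    | nil => simp [oneT]
    | cons b v => simp [oneT, hx (a :: b :: v) (by simp)]
  rw [prodL_cons, mulL_cons, hx [] (by simp), h]
  simp [mulL_oneT]

theorem prodL_eq_zero {l : List (Ten d)} (hl : ∀ x ∈ l, deg1 x) {w : Word d}
    (h : w.length ≠ l.length) : prodL l w = 0 := by
  induction l generalizing w with
  | nil => cases w <;> simp_all [prodL, oneT]
  | cons x l ih =>
    have hx : deg1 x := hl x (by simp)
    cases w with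
    | nil => simp [prodL_cons, mulL_nil, hx [] (by simp)]
    | cons a w =>
      rw [prodL_cons_cons hx, ih (fun y hy => hl y (by simp [hy])) (by simpa using h), mul_zero]

theorem prodL_append_append {l : List (Ten d)} (hl : ∀ x ∈ l, deg1 x) (l' : List (Ten d))
    {w : Word d} (h : w.length = l.length) (w' : Word d) :
    prodL (l ++ l') (w ++ w') = prodL l w * prodL l' w' := by
  induction l generalizing w with
  | nil =>
    obtain rfl : w = [] := by simpa using h
    simp [prodL, oneT]
  | cons x l ih =>
    have hx : deg1 x := hl x (by simp)
    cases w with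
    | nil => simp at h
    | cons a w =>
      rw [List.cons_append, List.cons_append, prodL_cons_cons hx, prodL_cons_cons hx,
        ih (fun y hy => hl y (by simp [hy])) (by simpa using h), mul_assoc]

theorem Nop_prodL {l : List (Ten d)} (hl : ∀ x ∈ l, deg1 x) (v : Word d) :
    Nop (prodL l) v = ∑ i ∈ Finset.range l.length, prodL (l.drop i ++ l.take i) v := by
  by_cases h : v.length = l.length
  · rw [Nop, sum_rotate_succ (prodL l), ← Finset.sum_range_reflect, h]
    refine Finset.sum_congr rfl fun i hi => ?_
    have hi : i < l.length := by simpa using hi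
    have e : l.length - 1 - i + 1 = l.length - i := by omega
    rw [e, List.rotate_eq_drop_append_take (by omega)]
    have hd : ∀ x ∈ l.drop i, deg1 x := fun x hx => hl x (List.mem_of_mem_drop hx)
    have ht : ∀ x ∈ l.take i, deg1 x := fun x hx => hl x (List.mem_of_mem_take hx)
    have key := prodL_append_append ht (l.drop i) (w := v.drop (l.length - i)) (by simp; omega)
      (v.take (l.length - i))
    have key' := prodL_append_append hd (l.take i) (w := v.take (l.length - i)) (by simp; omega)
      (v.drop (l.length - i))
    rw [List.take_append_drop] at key key'
    rw [key, key', mul_comm]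
  · rw [Nop, Finset.sum_eq_zero, Finset.sum_eq_zero]
    · intro i _
      refine prodL_eq_zero (fun x hx => hl x ?_) (by simp; omega)
      exact (List.mem_append.1 hx).elim List.mem_of_mem_drop List.mem_of_mem_take
    · intro i _
      exact prodL_eq_zero hl (by simpa using h)

theorem Nop_prodL_ofFn_cons {n : ℕ} {X : Fin n → Ten d} (hX : ∀ i, deg1 (X i)) (a : Fin d)
    (w : Word d) :
    Nop (prodL (List.ofFn X)) (a :: w) = ∑ i : Fin n, X i [a] *
      prodL ((List.ofFn X).drop ((i : ℕ) + 1) ++ (List.ofFn X).take (i : ℕ)) w := by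
  rw [Nop_prodL (by simpa [List.mem_ofFn] using hX), Finset.sum_range, List.length_ofFn]
  refine Finset.sum_congr rfl fun i _ => ?_
  rw [List.drop_eq_getElem_cons (by simp), List.cons_append, List.getElem_ofFn,
    prodL_cons_cons (hX i)]

/-- summing over all cuts of all rotations of `c :: m` amounts to summing over all pairs of
complementary arcs, according to which of the two contains the letter `c` -/
theorem sum_rotate_cut (K : Word d → Word d → ℚ) (c : Fin d) (m : Word d) :
    ∑ r ∈ Finset.range (c :: m).length, ∑ k ∈ Finset.range ((c :: m).length + 1),
        K (((c :: m).rotate r).take k) (((c :: m).rotate r).drop k)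
      = ∑ i ∈ Finset.range (m.length + 1), ∑ j ∈ Finset.Icc i m.length,
        (K ((m.take j).drop i) (m.drop j ++ c :: m.take i)
          + K (m.drop j ++ c :: m.take i) ((m.take j).drop i)) := by
  have e (i : ℕ) (hi : i ≤ m.length) :
      (c :: m).rotate (i + 1) = m.drop i ++ c :: m.take i := by
    rw [List.rotate_eq_drop_append_take (by simpa using hi)]
    simp
  rw [sum_rotate_succ (fun v => ∑ k ∈ Finset.range ((c :: m).length + 1), K (v.take k) (v.drop k))]
  simp only [Finset.sum_add_distrib]
  have swap : ∑ i ∈ Finset.range (m.length + 1), ∑ j ∈ Finset.Icc i m.length,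
        K (m.drop j ++ c :: m.take i) ((m.take j).drop i)
      = ∑ j ∈ Finset.range (m.length + 1), ∑ i ∈ Finset.range (j + 1),
        K (m.drop j ++ c :: m.take i) ((m.take j).drop i) := by
    refine Finset.sum_comm' fun i j => ?_
    simp only [Finset.mem_range, Finset.mem_Icc]
    omega
  rw [swap, ← Finset.sum_add_distrib]
  refine Finset.sum_congr rfl fun i hi => ?_
  have hi : i ≤ m.length := by simpa [Nat.lt_succ_iff] using hi
  have hlen : (c :: m).length + 1 = (m.length + 1 - i) + (i + 1) := by simp; omega
  rw [e i hi, hlen, Finset.sum_range_add, ← Finset.Ico_add_one_right_eq_Icc,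
    Finset.sum_Ico_eq_sum_range]
  congr 1
  · refine Finset.sum_congr rfl fun k hk => ?_
    have hk : k < m.length + 1 - i := by simpa using hk
    rw [List.take_append_of_le_length (by simp; omega),
      List.drop_append_of_le_length (by simp; omega), List.drop_drop, List.drop_take]
    simp
  · refine Finset.sum_congr rfl fun k hk => ?_
    have hk : k ≤ i := by simpa [Nat.lt_succ_iff] using hk
    have hl : m.length + 1 - i + k = (m.drop i).length + (k + 1) := by simp; omega
    rw [hl, List.take_length_add_append, List.drop_length_add_append, List.take_succ_cons,
      List.drop_succ_cons, List.take_take, min_eq_left hk]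

theorem pairC_swap {g : ℕ} (a b : Fin (2 * g)) : pairC a b = -pairC b a := by
  unfold pairC
  split_ifs <;> first | omega | norm_num

/-- the contraction of the first letters of `f` and `h` by the intersection pairing -/
def contract {g : ℕ} (f h : Ten (2 * g)) (u v : Word (2 * g)) : ℚ :=
  ∑ a : Fin (2 * g), ∑ b : Fin (2 * g), pairC a b * (f (a :: u) * h (b :: v))

theorem contract_swap {g : ℕ} (f h : Ten (2 * g)) (u v : Word (2 * g)) :
    contract f h u v = -contract h f v u := by
  simp only [contract]
  rw [Finset.sum_comm, ← Finset.sum_neg_distrib]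
  refine Finset.sum_congr rfl fun a _ => ?_
  rw [← Finset.sum_neg_distrib]
  refine Finset.sum_congr rfl fun b _ => ?_
  rw [pairC_swap b a]
  ring

theorem phiD_eq {g : ℕ} (f : Ten (2 * g)) (b : Fin (2 * g)) :
    phiD f b = ∑ c, pairC b c • lquot c f := by
  ext w
  simp [phiD]

theorem derL_phiD_lquot_Nop {g : ℕ} (f h : Ten (2 * g)) (c : Fin (2 * g)) (w : Word (2 * g)) :
    derL (phiD f) (lquot c (Nop h)) w
      = ∑ i ∈ Finset.range (w.length + 1), ∑ j ∈ Finset.Icc i w.length,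
        contract (Nop h) f (w.drop j ++ c :: w.take i) ((w.take j).drop i) := by
  rw [derL_apply]
  refine Finset.sum_congr rfl fun i _ => ?_
  refine Finset.sum_congr rfl fun j _ => ?_
  refine Finset.sum_congr rfl fun a _ => ?_
  rw [phiD, Finset.mul_sum]
  refine Finset.sum_congr rfl fun b _ => ?_
  have hcyc := Nop_append_comm h (c :: w.take i) (a :: w.drop j)
  simp only [List.cons_append] at hcyc
  rw [lquot_apply, hcyc]
  ring

theorem sum_comm_four {α β γ δ M : Type*} [AddCommMonoid M] (s : Finset α) (t : Finset β)
    (u : Finset γ) (v : Finset δ) (F : α → β → γ → δ → M) :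
    ∑ a ∈ s, ∑ b ∈ t, ∑ c ∈ u, ∑ e ∈ v, F a b c e
      = ∑ c ∈ u, ∑ e ∈ v, ∑ a ∈ s, ∑ b ∈ t, F a b c e := by
  simpa only [Finset.sum_product] using Finset.sum_comm (s := s ×ˢ t) (t := u ×ˢ v)
    (f := fun p q => F p.1 p.2 q.1 q.2)

theorem contract_Nop_prodL {g n m : ℕ} {X : Fin n → Ten (2 * g)} {Y : Fin m → Ten (2 * g)}
    (hX : ∀ i, deg1 (X i)) (hY : ∀ j, deg1 (Y j)) (u v : Word (2 * g)) :
    contract (Nop (prodL (List.ofFn X))) (Nop (prodL (List.ofFn Y))) u v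
      = ∑ i : Fin n, ∑ j : Fin m, pairT (X i) (Y j) *
        (prodL ((List.ofFn X).drop ((i : ℕ) + 1) ++ (List.ofFn X).take (i : ℕ)) u *
          prodL ((List.ofFn Y).drop ((j : ℕ) + 1) ++ (List.ofFn Y).take (j : ℕ)) v) := by
  simp only [contract, Nop_prodL_ofFn_cons hX, Nop_prodL_ofFn_cons hY, pairT,
    Finset.mul_sum, Finset.sum_mul]
  refine (sum_comm_four _ _ _ _ _).trans (Finset.sum_comm.trans ?_)
  refine Finset.sum_congr rfl fun i _ => ?_
  refine Finset.sum_congr rfl fun j _ => ?_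
  refine Finset.sum_congr rfl fun a _ => ?_
  refine Finset.sum_congr rfl fun b _ => ?_
  ring

theorem sum_pairT_Nop_prodL {g n m : ℕ} {X : Fin n → Ten (2 * g)} {Y : Fin m → Ten (2 * g)}
    (hX : ∀ i, deg1 (X i)) (hY : ∀ j, deg1 (Y j)) (w : Word (2 * g)) :
    ∑ i : Fin n, ∑ j : Fin m, pairT (X i) (Y j) *
        Nop (prodL ((List.ofFn X).drop ((i : ℕ) + 1) ++ (List.ofFn X).take (i : ℕ)
          ++ (List.ofFn Y).drop ((j : ℕ) + 1) ++ (List.ofFn Y).take (j : ℕ))) w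
      = ∑ r ∈ Finset.range w.length, ∑ k ∈ Finset.range (w.length + 1),
        contract (Nop (prodL (List.ofFn X))) (Nop (prodL (List.ofFn Y)))
          ((w.rotate r).take k) ((w.rotate r).drop k) := by
  simp only [contract_Nop_prodL hX hY]
  rw [sum_comm_four]
  refine Finset.sum_congr rfl fun i _ => ?_
  refine Finset.sum_congr rfl fun j _ => ?_
  rw [Nop, Finset.mul_sum]
  refine Finset.sum_congr rfl fun r _ => ?_
  rw [List.append_assoc _ _ ((List.ofFn Y).take (j : ℕ)), prodL_append, mulL_apply,
    List.length_rotate, Finset.mul_sum]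

/-- For `X₁,…,X_n, Y₁,…,Y_m ∈ H`, viewing `N(X₁⋯X_n)` and
`N(Y₁⋯Y_m)` as derivations of `T̂` via Poincaré duality, their Lie bracket as
derivations equals
`-∑ᵢ∑ⱼ (Xᵢ·Yⱼ) N(X_{i+1}⋯X_n X₁⋯X_{i-1} Y_{j+1}⋯Y_m Y₁⋯Y_{j-1})`. -/
theorem bracket_of_Nop_derivations (g n m : ℕ) (hn : 1 ≤ n) (hm : 1 ≤ m)
    (X : Fin n → Ten (2 * g)) (Y : Fin m → Ten (2 * g))
    (hX : ∀ i, deg1 (X i)) (hY : ∀ j, deg1 (Y j)) :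
    ∀ t : Ten (2 * g),
      derOf (Nop (prodL (List.ofFn X))) (derOf (Nop (prodL (List.ofFn Y))) t)
        - derOf (Nop (prodL (List.ofFn Y))) (derOf (Nop (prodL (List.ofFn X))) t)
      = derOf (fun w => - ∑ i : Fin n, ∑ j : Fin m, pairT (X i) (Y j) *
          Nop (prodL ((List.ofFn X).drop ((i : ℕ) + 1) ++ (List.ofFn X).take (i : ℕ)
            ++ (List.ofFn Y).drop ((j : ℕ) + 1) ++ (List.ofFn Y).take (j : ℕ))) w) t := by
  intro t
  change derL (phiD _) (derL (phiD _) t) - derL (phiD _) (derL (phiD _) t) = derL (phiD _) t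
  rw [derL_commutator]
  congr 2
  ext b w
  rw [phiD_eq _ b, phiD_eq _ b, phiD_eq _ b, map_sum, map_sum, ← Finset.sum_sub_distrib,
    Finset.sum_apply, Finset.sum_apply]
  refine Finset.sum_congr rfl fun c _ => ?_
  simp only [map_smul, Pi.sub_apply, Pi.smul_apply, smul_eq_mul, ← mul_sub, lquot_apply]
  congr 1
  rw [derL_phiD_lquot_Nop, derL_phiD_lquot_Nop, sum_pairT_Nop_prodL hX hY,
    sum_rotate_cut (contract _ _), ← Finset.sum_sub_distrib, ← Finset.sum_neg_distrib]
  refine Finset.sum_congr rfl fun i _ => ?_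
  rw [← Finset.sum_sub_distrib, ← Finset.sum_neg_distrib]
  refine Finset.sum_congr rfl fun j _ => ?_
  rw [contract_swap (Nop (prodL (List.ofFn Y)))]
  ring

end Paper
end

section
/- Let θ be a group-like Magnus expansion. Then for x ∈ π: (1) the degree-2 part of L^θ(x) equals [x]⊗[x], and (2) the degree-3 part of L^θ(x) equals [x] ∧ ℓ₂^θ(x), an element of Λ³H embedded in H^{⊗3} by full antisymmetrization. -/
/-! Model of the completed tensor algebra `T̂` of `H = ℚ^d`: an element of `T̂`
is a function assigning to each word in the basis letters (elements of `Fin d`)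
its coefficient. -/

namespace Paper

variable {d : ℕ}

/-- the logarithm `log : 1 + T̂₁ → T̂₁`, computed degreewise by the usual series
`log(1+a) = ∑ (-1)^{n-1} aⁿ/n` (only finitely many terms contribute in each
degree). -/
def logT (f : Ten d) : Ten d :=
  fun w => ∑ n ∈ Finset.Icc 1 w.length, ((-1 : ℚ) ^ (n - 1) / (n : ℚ)) * powT (f - oneT) n w

/-- the exponent sum of the generator `i` in a word of the free group; the
`i`-th coordinate of the homology class `[x] ∈ H = H₁(F;ℚ)`. -/
def expQ (i : Fin d) (x : FreeGroup (Fin d)) : ℚ :=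
  ((Multiplicative.toAdd
    ((FreeGroup.lift (fun j : Fin d =>
      Multiplicative.ofAdd (if j = i then (1 : ℤ) else 0))) x) : ℤ) : ℚ)

/-- `θ` is a (ℚ-valued) Magnus expansion of the free group `F_d`:
a group homomorphism into `1 + T̂₁` with `θ(x) ≡ 1 + [x] mod T̂₂`. -/
def IsMagnus (θ : FreeGroup (Fin d) → Ten d) : Prop :=
  θ 1 = oneT ∧ (∀ x y, θ (x * y) = mulT (θ x) (θ y)) ∧
    (∀ x, θ x [] = 1) ∧ (∀ x (i : Fin d), θ x [i] = expQ i x)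

/-- the invariant `L^θ(x) = ½ N(ℓ^θ(x) ℓ^θ(x))`, where `ℓ^θ = log θ`. -/
def LT (f : Ten d) : Ten d := fun w => (1 / 2 : ℚ) * Nop (mulT (logT f) (logT f)) w
/-- the basis letter `i`, as a degree-one element of `T̂` -/
def singT (i : Fin d) : Ten d := fun w => if w = [i] then 1 else 0

/-- the right-normed iterated bracket `[x₁,[x₂,[⋯,[x_{k-1},x_k]⋯]]]` of a list
of elements of `T̂` (a single element for a singleton, `0` for the empty list). -/
def rightBr : List (Ten d) → Ten d
  | [] => 0
  | [x] => x
  | x :: l => brT x (rightBr l)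

/-- the left-normed iterated bracket `[⋯[[x,y₁],y₂],⋯,y_k]`. -/
def leftBr (x : Ten d) (l : List (Ten d)) : Ten d := l.foldl brT x

/-- the right-normed bracket of the letters of a word -/
def PhiWord : Word d → Ten d
  | [] => 0
  | [x] => singT x
  | x :: l => brT (singT x) (PhiWord l)

/-- the degree-`p` truncation (homogeneous part) of an element of `T̂` -/
def truncT (p : ℕ) (f : Ten d) : Ten d := fun w => if w.length = p then f w else 0

/-- the degree-`p` part `𝓛_p` of the free Lie algebra generated by `H` inside
`T̂` (spanned by the right-normed brackets of words of length `p`) -/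
def LieN (d p : ℕ) : Submodule ℚ (Ten d) :=
  Submodule.span ℚ {g : Ten d | ∃ w : Word d, w.length = p ∧ g = PhiWord w}

/-- membership in the completed free Lie algebra `𝓛̂ ⊂ T̂`: every homogeneous
component is a Lie element. -/
def memLhat (f : Ten d) : Prop := ∀ p : ℕ, truncT p f ∈ LieN d p

/-- membership in (the closure of) `H ⊗ 𝓛̂ ⊂ T̂₁`. -/
def memHLhat (f : Ten d) : Prop :=
  ∀ p : ℕ, truncT p f ∈ Submodule.span ℚ
    {g : Ten d | ∃ X v : Ten d, deg1 X ∧ memLhat v ∧ g = mulT X v}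

/-- membership in (the closure of) `𝓛̂ ⊗ 𝓛̂ ⊂ T̂`. -/
def memLLhat (f : Ten d) : Prop :=
  ∀ p : ℕ, truncT p f ∈ Submodule.span ℚ
    {g : Ten d | ∃ u v : Ten d, memLhat u ∧ memLhat v ∧ g = mulT u v}

/-- the homology class `[x] ∈ H ⊂ T̂` of an element of the free group -/
def clT (x : FreeGroup (Fin d)) : Ten d :=
  fun w => match w with
  | [i] => expQ i x
  | _ => 0

/-- The logarithm has no constant term. -/
lemma logT_nil (f : Ten d) : logT f [] = 0 := by
  simp [logT]

/-- In degree one, `log f` agrees with `f`. -/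
lemma logT_singleton (f : Ten d) (i : Fin d) : logT f [i] = f [i] := by
  simp [logT, powT, mulT, oneT, Finset.sum_range_succ]

/-- Lie elements of degree two are antisymmetric. -/
lemma LieN_two_antisymm {g : Ten d} (hg : g ∈ LieN d 2) (a b : Fin d) :
    g [a, b] = - g [b, a] := by
  induction hg using Submodule.span_induction with
  | mem g hg =>
    obtain ⟨w, hw, rfl⟩ := hg
    obtain ⟨i, j, rfl⟩ := List.length_eq_two.mp hw
    simp [PhiWord, brT, mulT, singT, Finset.sum_range_succ]
    split_ifs <;> simp
  | zero => simp
  | add f g _ _ hf hg => simp only [Pi.add_apply, hf, hg]; ring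
  | smul c f _ hf => simp only [Pi.smul_apply, smul_eq_mul, hf]; ring

/-- The degree-two part of an element of the completed free Lie algebra is antisymmetric. -/
lemma memLhat_antisymm {f : Ten d} (hf : memLhat f) (a b : Fin d) :
    f [a, b] = - f [b, a] := by
  simpa [truncT] using LieN_two_antisymm (hf 2) a b

/-- The degree-two coefficients of `½ N(ℓℓ)`. -/
lemma LT_pair (f : Ten d) (a b : Fin d) :
    LT f [a, b] = logT f [a] * logT f [b] := by
  simp [LT, Nop, mulT, Finset.sum_range_succ, logT_nil]
  ring

/-- The degree-three coefficients of `½ N(ℓℓ)`. -/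
lemma LT_triple (f : Ten d) (a b c : Fin d) :
    LT f [a, b, c] = logT f [a] * logT f [b, c] + logT f [b] * logT f [c, a] +
      logT f [c] * logT f [a, b] := by
  simp [LT, Nop, mulT, Finset.sum_range_succ, logT_nil]
  ring

/-- Let `θ` be a group-like Magnus expansion.  Then for
`x ∈ π`: (1) the degree-2 part of `L^θ(x)` is `[x]⊗[x]`; and (2) the degree-3
part of `L^θ(x)` is `[x] ∧ ℓ₂^θ(x) = N([x]·ℓ₂^θ(x))`, an element of `Λ³H`
(i.e. a fully antisymmetric tensor) in `H^{⊗3}`. -/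
theorem LT_low_degrees (d : ℕ) (θ : FreeGroup (Fin d) → Ten d)
    (hθ : IsMagnus θ) (hgl : ∀ x, memLhat (logT (θ x))) (x : FreeGroup (Fin d)) :
    (∀ w : Word d, w.length = 2 → LT (θ x) w = mulT (clT x) (clT x) w) ∧
    (∀ w : Word d, w.length = 3 →
      LT (θ x) w = Nop (mulT (clT x) (truncT 2 (logT (θ x)))) w) ∧
    (∀ a b c : Fin d, LT (θ x) [a, b, c] = - LT (θ x) [b, a, c]) ∧
    (∀ a b c : Fin d, LT (θ x) [a, b, c] = - LT (θ x) [a, c, b]) := by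
  obtain ⟨-, -, -, h1⟩ := hθ
  have hl (i : Fin d) : logT (θ x) [i] = expQ i x := by
    rw [logT_singleton, h1]
  have hanti := memLhat_antisymm (hgl x)
  refine ⟨fun w hw => ?_, fun w hw => ?_, fun a b c => ?_, fun a b c => ?_⟩
  · obtain ⟨a, b, rfl⟩ := List.length_eq_two.mp hw
    simp [LT_pair, hl, mulT, clT, Finset.sum_range_succ]
  · obtain ⟨a, b, c, rfl⟩ := List.length_eq_three.mp hw
    simp [LT_triple, hl, Nop, mulT, clT, truncT, Finset.sum_range_succ]
  · rw [LT_triple, LT_triple, hanti b c, hanti c a, hanti a b]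
    ring
  · rw [LT_triple, LT_triple, hanti b c, hanti c a, hanti a b]
    ring

end Paper
end
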